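/- arXiv:0901.4478 — 5 statements merged into one kernel-verified Lean document; each statement's English description precedes it below -/
import Mathlib

section
/- Let k be a field, V a k-vector space, α a nonempty set, and f₁,…,f_m : α → V functions that are linearly independent in the k-vector space of all functions α → V. Then there exist a natural number r with 1 ≤ r ≤ m and points a₁,…,a_r ∈ α such that the m vectors (f₁(a₁),…,f₁(a_r)), …, (f_m(a₁),…,f_m(a_r)) of V^r are linearly independent over k. -/
/-- A family of linear maps whose kernels meet trivially has, on any subspace of dimension at
most `n`, a subfamily of `n` members whose kernels already meet that subspace trivially. -/
theorem exists_fin_forall_apply_eq_zero_imp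
    {k M V α : Type*} [Field k] [AddCommGroup M] [Module k M] [FiniteDimensional k M]
    [AddCommGroup V] [Module k V] [Nonempty α] (L : α → M →ₗ[k] V)
    (hL : ∀ c, (∀ x, L x c = 0) → c = 0) (n : ℕ) (W : Submodule k M)
    (hW : Module.finrank k W ≤ n) :
    ∃ a : Fin n → α, ∀ c ∈ W, (∀ j, L (a j) c = 0) → c = 0 := by
  induction n generalizing W with
  | zero =>
    have hbot : W = ⊥ := Submodule.finrank_eq_zero.mp (Nat.le_zero.mp hW)
    exact ⟨Fin.elim0, fun c hc _ => by simpa [hbot] using hc⟩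
  | succ n ih =>
    by_cases hbot : W = ⊥
    · exact ⟨fun _ => Classical.arbitrary α, fun c hc _ => by simpa [hbot] using hc⟩
    · obtain ⟨c, hcW, hc⟩ := W.ne_bot_iff.mp hbot
      obtain ⟨x, hx⟩ : ∃ x, L x c ≠ 0 := by
        by_contra! h
        exact hc (hL c h)
      have hlt : W ⊓ LinearMap.ker (L x) < W :=
        lt_of_le_of_ne inf_le_left fun h => hx (inf_eq_left.mp h hcW)
      obtain ⟨a, ha⟩ := ih (W ⊓ LinearMap.ker (L x))
        (Nat.lt_succ_iff.mp ((Submodule.finrank_lt_finrank_of_lt hlt).trans_le hW))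
      refine ⟨Fin.cons x a, fun d hd h => ha d ⟨hd, ?_⟩ fun j => ?_⟩
      · simpa using h 0
      · simpa using h j.succ

/-- If `f 0, …, f (m-1) : α → V` are linearly independent functions (in the `k`-vector
space of all functions `α → V`, `α` nonempty), then there are `r` points `a 0, …, a (r-1)`
of `α`, with `1 ≤ r ≤ m`, such that the `m` evaluation vectors
`(f i (a 0), …, f i (a (r-1))) ∈ V^r` are linearly independent over `k`. -/
theorem exists_points_eval_linearIndependent
    {k V α : Type*} [Field k] [AddCommGroup V] [Module k V] [Nonempty α]
    {m : ℕ} (hm : 1 ≤ m) (f : Fin m → α → V)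
    (hf : LinearIndependent k f) :
    ∃ r : ℕ, 1 ≤ r ∧ r ≤ m ∧ ∃ a : Fin r → α,
      LinearIndependent k (fun i : Fin m => fun j : Fin r => f i (a j)) := by
  obtain ⟨a, ha⟩ := exists_fin_forall_apply_eq_zero_imp
    (fun x => Fintype.linearCombination k fun i => f i x)
    (fun c h => funext <| Fintype.linearIndependent_iff.mp hf c <| funext fun x => by
      simpa [Fintype.linearCombination_apply] using h x)
    m (⊤ : Submodule k (Fin m → k)) (by simp)
  refine ⟨m, hm, le_rfl, a, Fintype.linearIndependent_iff.mpr fun c hc => ?_⟩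
  refine congrFun (ha c trivial fun j => ?_)
  simpa [Fintype.linearCombination_apply] using congrFun hc j
end

section
/- Let U ⊆ ℂⁿ be a nonempty connected open set and Y₁,…,Y_m : U → ℂⁿ complex analytic maps that are linearly independent over ℂ in the vector space of maps U → ℂⁿ. Then there exists r ≥ 1 such that the set of r-tuples (x₁,…,x_r) ∈ U^r at which the m vectors (Yᵢ(x₁),…,Yᵢ(x_r)) ∈ (ℂⁿ)^r, i = 1,…,m, are linearly independent over ℂ is an open and dense subset of U^r. -/
/-- If every nonzero `c` is detected by some `L x` with `x` in any of the sets `V j`, then one can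
choose points `x j ∈ V j` so that each of them cuts down the common kernel of the `L (x j)` until
it vanishes. -/
theorem exists_forall_mem_finrank_iInf_ker_le {K W F X : Type*} [Field K] [AddCommGroup W]
    [Module K W] [FiniteDimensional K W] [AddCommGroup F] [Module K F] (L : X → W →ₗ[K] F)
    {r : ℕ} (V : Fin r → Set X) (hV : ∀ j, (V j).Nonempty)
    (hL : ∀ j, ∀ c : W, c ≠ 0 → ∃ x ∈ V j, L x c ≠ 0) :
    ∃ x : Fin r → X, (∀ j, x j ∈ V j) ∧
      Module.finrank K (⨅ j, LinearMap.ker (L (x j)) : Submodule K W) ≤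
        Module.finrank K W - r := by
  induction r with
  | zero => exact ⟨Fin.elim0, fun j => j.elim0, Submodule.finrank_le _⟩
  | succ r ih =>
    obtain ⟨x, hxV, hx⟩ := ih (fun j => V j.succ) (fun j => hV _) (fun j => hL _)
    have hinf (y : X) : (⨅ j, LinearMap.ker (L ((Fin.cons y x : Fin (r + 1) → X) j))) =
        LinearMap.ker (L y) ⊓ ⨅ j, LinearMap.ker (L (x j)) := by
      ext c
      simp [Fin.forall_fin_succ]
    have hmem {y : X} (hy : y ∈ V 0) (j) : (Fin.cons y x : Fin (r + 1) → X) j ∈ V j :=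
      Fin.cases hy hxV j
    by_cases hbot : (⨅ j, LinearMap.ker (L (x j))) = ⊥
    · obtain ⟨y, hy⟩ := hV 0
      refine ⟨Fin.cons y x, hmem hy, ?_⟩
      rw [hinf, hbot, inf_bot_eq, finrank_bot]
      exact Nat.zero_le _
    · obtain ⟨c, hc, hc0⟩ := Submodule.exists_mem_ne_zero_of_ne_bot hbot
      obtain ⟨y, hy, hyc⟩ := hL 0 c hc0
      refine ⟨Fin.cons y x, hmem hy, ?_⟩
      rw [hinf]
      have hlt : LinearMap.ker (L y) ⊓ (⨅ j, LinearMap.ker (L (x j))) <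
          ⨅ j, LinearMap.ker (L (x j)) :=
        lt_of_le_of_ne inf_le_right fun h => hyc (inf_eq_right.1 h hc)
      have := Submodule.finrank_lt_finrank_of_lt hlt
      omega

/-- A nontrivial linear combination of linearly independent analytic maps on a preconnected set
does not vanish identically on any open subset. -/
theorem exists_mem_sum_smul_ne_zero_of_analyticOnNhd {𝕜 E F ι : Type*}
    [NontriviallyNormedField 𝕜] [NormedAddCommGroup E] [NormedSpace 𝕜 E]
    [NormedAddCommGroup F] [NormedSpace 𝕜 F] [Fintype ι] {U V : Set E} (hU : IsPreconnected U)
    {Y : ι → E → F} (hY : ∀ i, AnalyticOnNhd 𝕜 (Y i) U)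
    (hli : LinearIndependent 𝕜 fun i => U.domRestrict (Y i))
    (hV : IsOpen V) {z : E} (hzU : z ∈ U) (hzV : z ∈ V) {c : ι → 𝕜} (hc : c ≠ 0) :
    ∃ x ∈ V, ∑ i, c i • Y i x ≠ 0 := by
  by_contra! h
  have han : AnalyticOnNhd 𝕜 (fun x => ∑ i, c i • Y i x) U :=
    Finset.univ.analyticOnNhd_fun_sum fun i _ => analyticOnNhd_const.smul (hY i)
  have hzero := han.eqOn_zero_of_preconnected_of_eventuallyEq_zero hU hzU
    (Filter.eventually_of_mem (hV.mem_nhds hzV) h)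
  refine hc (funext (Fintype.linearIndependent_iff.1 hli c (funext fun x => ?_)))
  simpa [Set.domRestrict] using hzero x.2


/-- Let `U ⊆ ℂⁿ` be a nonempty connected open set and `Y 0, …, Y (m-1)` complex analytic
maps `U → ℂⁿ` that are linearly independent over `ℂ` as elements of the space of maps
`U → ℂⁿ`.  Then there is an `r ≥ 1` such that the set of `r`-tuples
`(a 0, …, a (r-1)) ∈ U^r` at which the `m` vectors `(Y i (a 0), …, Y i (a (r-1))) ∈ (ℂⁿ)^r`
are linearly independent over `ℂ` is open and dense in `U^r`. -/
theorem exists_pow_lift_linearIndependent_open_dense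
    {n : ℕ} {U : Set (Fin n → ℂ)} (hUne : U.Nonempty) (hUo : IsOpen U)
    (hUc : IsConnected U)
    {m : ℕ} (Y : Fin m → (Fin n → ℂ) → (Fin n → ℂ))
    (hYan : ∀ i, AnalyticOnNhd ℂ (Y i) U)
    (hYli : LinearIndependent ℂ fun i : Fin m => U.restrict (Y i)) :
    ∃ r : ℕ, 1 ≤ r ∧
      IsOpen {a : Fin r → Fin n → ℂ | (∀ j, a j ∈ U) ∧
        LinearIndependent ℂ fun i : Fin m => fun j : Fin r => Y i (a j)} ∧
      ∀ a : Fin r → Fin n → ℂ, (∀ j, a j ∈ U) →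
        a ∈ closure {a : Fin r → Fin n → ℂ | (∀ j, a j ∈ U) ∧
          LinearIndependent ℂ fun i : Fin m => fun j : Fin r => Y i (a j)} := by
  refine ⟨m + 1, Nat.le_add_left 1 m, ?_, fun a ha => ?_⟩
  · have hpi : IsOpen {a : Fin (m + 1) → Fin n → ℂ | ∀ j, a j ∈ U} := by
      simpa [Set.pi] using isOpen_set_pi (Set.toFinite Set.univ) fun (_ : Fin (m + 1)) _ => hUo
    have hcont : ContinuousOn (fun (a : Fin (m + 1) → Fin n → ℂ) (i : Fin m) (j : Fin (m + 1)) =>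
        Y i (a j)) {a | ∀ j, a j ∈ U} :=
      continuousOn_pi.2 fun i => continuousOn_pi.2 fun j =>
        (hYan i).continuousOn.comp (continuous_apply j).continuousOn fun a ha => ha j
    exact hcont.isOpen_inter_preimage hpi isOpen_setOfPred_linearIndependent
  · rw [mem_closure_iff_nhds_basis Metric.nhds_basis_ball]
    intro ε hε
    obtain ⟨x, hx, hrank⟩ := exists_forall_mem_finrank_iInf_ker_le
      (fun x => Fintype.linearCombination ℂ fun i => Y i x)
      (fun j : Fin (m + 1) => Metric.ball (a j) ε ∩ U)
      (fun j => ⟨a j, Metric.mem_ball_self hε, ha j⟩)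
      fun j c hc => exists_mem_sum_smul_ne_zero_of_analyticOnNhd hUc.isPreconnected hYan hYli
        (Metric.isOpen_ball.inter hUo) (ha j) ⟨Metric.mem_ball_self hε, ha j⟩ hc
    refine ⟨x, ⟨fun j => (hx j).2, ?_⟩, (dist_pi_lt_iff hε).2 fun j => (hx j).1⟩
    have hbot : (⨅ j, LinearMap.ker (Fintype.linearCombination ℂ fun i => Y i (x j))) = ⊥ := by
      rw [← Submodule.finrank_eq_zero (R := ℂ)]
      simpa using hrank
    refine Fintype.linearIndependent_iff.2 fun c hc => congrFun ?_
    change c = 0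
    rw [← Submodule.mem_bot ℂ, ← hbot]
    simp only [Submodule.mem_iInf, LinearMap.mem_ker, Fintype.linearCombination_apply]
    intro j
    simpa using congrFun hc j
end

section
/- Let U ⊆ ℂⁿ be a nonempty connected open set, let ξ₁,…,ξ_s : U → ℂⁿ be complex analytic maps, and let r ≥ 1. Assume there exists a point (x₀⁽¹⁾,…,x₀⁽ʳ⁾) ∈ U^r at which the s vectors (ξ_k(x₀⁽¹⁾),…,ξ_k(x₀⁽ʳ⁾)) ∈ (ℂⁿ)^r, k = 1,…,s, are linearly independent over ℂ. Let λ₁,…,λ_s : U^{r+1} → ℂ be analytic functions such that for every index a ∈ {1,…,r+1} there exists a map η_a : U → ℂⁿ with Σ_{k=1}^s λ_k(x⁽¹⁾,…,x⁽ʳ⁺¹⁾)·ξ_k(x⁽ᵃ⁾) = η_a(x⁽ᵃ⁾) for all (x⁽¹⁾,…,x⁽ʳ⁺¹⁾) ∈ U^{r+1}, i.e. each combination Σ_k λ_k·ξ_k(x⁽ᵃ⁾) depends only on the a-th variable. Then every function λ_k is constant on U^{r+1}. -/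
/-- A function on `U^{r+1}` that does not change when a single coordinate is replaced is
constant. -/
theorem eq_of_forall_update_eq {ι E F : Type*} [Fintype ι] [DecidableEq ι] {U : Set E}
    {f : (ι → E) → F}
    (hf : ∀ a, ∀ x : ι → E, (∀ b, x b ∈ U) → ∀ p ∈ U, f (Function.update x a p) = f x)
    {x y : ι → E} (hx : ∀ b, x b ∈ U) (hy : ∀ b, y b ∈ U) : f x = f y := by
  have key : ∀ S : Finset ι, f (S.piecewise y x) = f x := by
    intro S
    induction S using Finset.induction_on with
    | empty => simp
    | insert a S _ ih =>
      rw [Finset.piecewise_insert, hf a _ _ _ (hy a), ih]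
      intro b
      by_cases hb : b ∈ S <;> simp [hb, hx b, hy b]
  simpa using (key Finset.univ).symm

/-- Inserting a fixed vector as the `a`-th coordinate is analytic. -/
theorem analyticAt_insertNth {E : Type*} [NormedAddCommGroup E] [NormedSpace ℂ E] {r : ℕ}
    (a : Fin (r + 1)) (p : E) (z : Fin r → E) :
    AnalyticAt ℂ (fun y : Fin r → E => (a.insertNth p y : Fin (r + 1) → E)) z := by
  refine AnalyticAt.pi fun b => ?_
  induction b using a.succAboveCases with
  | x => simpa using analyticAt_const
  | p j =>
    simp only [Fin.insertNth_apply_succAbove]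
    exact (ContinuousLinearMap.proj (R := ℂ) (φ := fun _ : Fin r => E) j).analyticAt z

/-- A coefficient vector is determined by the combinations it forms at the points of a tuple at
which the evaluated family is linearly independent. -/
theorem LinearIndependent.coeff_eq_of_forall_sum_smul_eq {ι κ M : Type*} [Fintype ι]
    [AddCommGroup M] [Module ℂ M] {v : ι → κ → M} (hv : LinearIndependent ℂ v)
    {c d : ι → ℂ} (h : ∀ j, ∑ k, c k • v k j = ∑ k, d k • v k j) : c = d := by
  refine hv.fintypeLinearCombination_injective ?_
  ext1 j
  simpa [Fintype.linearCombination_apply, Finset.sum_apply] using h j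


/-- Let `U ⊆ ℂⁿ` be a nonempty connected open set, `ξ 0, …, ξ (s-1) : U → ℂⁿ` analytic
maps, and `r ≥ 1`.  Assume there is a point `(x₀ 0, …, x₀ (r-1)) ∈ U^r` at which the `s`
vectors `(ξ k (x₀ 0), …, ξ k (x₀ (r-1))) ∈ (ℂⁿ)^r` are linearly independent over `ℂ`.
If `λ 0, …, λ (s-1) : U^{r+1} → ℂ` are analytic functions such that for every index `a`
the combination `∑ k, λ k x • ξ k (x a)` depends only on the `a`-th variable `x a`, then
every `λ k` is constant on `U^{r+1}`. -/
theorem structure_functions_constant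
    {n : ℕ} {U : Set (Fin n → ℂ)} (hUne : U.Nonempty) (hUo : IsOpen U)
    (hUc : IsConnected U)
    {s : ℕ} (ξ : Fin s → (Fin n → ℂ) → (Fin n → ℂ))
    (hξan : ∀ k, AnalyticOnNhd ℂ (ξ k) U)
    (r : ℕ) (hr : 1 ≤ r)
    (x₀ : Fin r → Fin n → ℂ) (hx₀ : ∀ j, x₀ j ∈ U)
    (hind : LinearIndependent ℂ fun k : Fin s => fun j : Fin r => ξ k (x₀ j))
    (lam : Fin s → (Fin (r + 1) → Fin n → ℂ) → ℂ)
    (hlam : ∀ k, AnalyticOnNhd ℂ (lam k) {x : Fin (r + 1) → Fin n → ℂ | ∀ a, x a ∈ U})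
    (hdep : ∀ a : Fin (r + 1), ∃ η : (Fin n → ℂ) → (Fin n → ℂ),
      ∀ x : Fin (r + 1) → Fin n → ℂ, (∀ b, x b ∈ U) →
        (∑ k, lam k x • ξ k (x a)) = η (x a)) :
    ∀ k, ∀ x : Fin (r + 1) → Fin n → ℂ, (∀ a, x a ∈ U) →
      ∀ y : Fin (r + 1) → Fin n → ℂ, (∀ a, y a ∈ U) → lam k x = lam k y := by
  classical
  intro k x hx y hy
  refine eq_of_forall_update_eq (U := U) (fun a x hx p hp => ?_) hx hy
  have hmem : ∀ q ∈ U, ∀ z : Fin r → Fin n → ℂ, (∀ j, z j ∈ U) →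
      ∀ b, (a.insertNth q z : Fin (r + 1) → Fin n → ℂ) b ∈ U := by
    intro q hq z hz b
    induction b using a.succAboveCases with
    | x => simpa using hq
    | p j => simpa using hz j
  have han : ∀ q ∈ U, AnalyticOnNhd ℂ
      (fun z : Fin r → Fin n → ℂ => lam k (a.insertNth q z)) (Set.univ.pi fun _ => U) :=
    fun q hq z hz => (hlam k _ (hmem q hq z fun j => hz j trivial)).comp
      (f := fun z : Fin r → Fin n → ℂ => (a.insertNth q z : Fin (r + 1) → Fin n → ℂ))
      (analyticAt_insertNth a q z)
  have hcont : ContinuousAt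
      (fun (z : Fin r → Fin n → ℂ) (k : Fin s) (j : Fin r) => ξ k (z j)) x₀ := by
    refine continuousAt_pi.2 fun k => continuousAt_pi.2 fun j => ?_
    exact ContinuousAt.comp (f := fun z : Fin r → Fin n → ℂ => z j)
      (hξan k _ (hx₀ j)).continuousAt (continuous_apply j).continuousAt
  have hnear : (fun z : Fin r → Fin n → ℂ => lam k (a.insertNth p z)) =ᶠ[nhds x₀]
      fun z => lam k (a.insertNth (x a) z) := by
    filter_upwards [hcont.eventually (isOpen_setOfPred_linearIndependent.mem_nhds hind),
      (isOpen_set_pi Set.finite_univ fun _ _ => hUo).mem_nhds fun j _ => hx₀ j] with z hz hzU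
    have hzU' : ∀ j, z j ∈ U := fun j => hzU j trivial
    refine congrFun (LinearIndependent.coeff_eq_of_forall_sum_smul_eq hz
      (c := fun k => lam k (a.insertNth p z))
      (d := fun k => lam k (a.insertNth (x a) z)) fun j => ?_) k
    obtain ⟨η, hη⟩ := hdep (a.succAbove j)
    have h₁ := hη _ (hmem p hp z hzU')
    have h₂ := hη _ (hmem (x a) (hx a) z hzU')
    simp only [Fin.insertNth_apply_succAbove] at h₁ h₂
    exact h₁.trans h₂.symm
  have heq := (han p hp).eqOn_of_preconnected_of_eventuallyEq (han (x a) (hx a))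
    (isPreconnected_univ_pi fun _ => hUc.isPreconnected) (fun j _ => hx₀ j) hnear
    (x := a.removeNth x) (fun j _ => hx _)
  simpa [Fin.insertNth_removeNth] using heq
end

section
/- Let I ⊆ ℝ be an interval, let a, b, c : I → ℂ be functions, and let x₁, x₂, x₃, x₄ : I → ℂ be differentiable functions each satisfying the Riccati equation x′(t) = a(t) + b(t)·x(t) + c(t)·x(t)² on I. Assume that (x₁(t) − x₄(t))·(x₃(t) − x₂(t)) ≠ 0 for all t ∈ I. Then the anharmonic (cross) ratio t ↦ ((x₁(t) − x₂(t))·(x₃(t) − x₄(t))) / ((x₁(t) − x₄(t))·(x₃(t) − x₂(t))) is constant on I. -/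
/-- A function whose derivative within an interval vanishes identically is constant there. -/
theorem Set.OrdConnected.eq_of_hasDerivWithinAt_zero {I : Set ℝ} (hI : I.OrdConnected)
    {f : ℝ → ℂ} (hf : ∀ t ∈ I, HasDerivWithinAt f 0 I t) :
    ∀ t ∈ I, ∀ t' ∈ I, f t = f t' := by
  intro t ht t' ht'
  have h := hI.convex.norm_image_sub_le_of_norm_hasDerivWithin_le (C := 0) hf
    (fun _ _ => norm_zero.le) ht' ht
  rw [zero_mul] at h
  exact sub_eq_zero.mp (norm_le_zero_iff.mp h)

/-- If `x₁, x₂, x₃, x₄` are four solutions on an interval `I ⊆ ℝ` of the Riccati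
equation `x′ = a(t) + b(t)·x + c(t)·x²`, and `(x₁ - x₄)(x₃ - x₂)` never vanishes on `I`,
then the anharmonic (cross) ratio `((x₁ - x₂)(x₃ - x₄)) / ((x₁ - x₄)(x₃ - x₂))` is
constant on `I`. -/
theorem riccati_cross_ratio_constant
    (I : Set ℝ) (hI : I.OrdConnected) (a b c : ℝ → ℂ)
    (x₁ x₂ x₃ x₄ : ℝ → ℂ)
    (h₁ : ∀ t ∈ I, HasDerivWithinAt x₁ (a t + b t * x₁ t + c t * x₁ t ^ 2) I t)
    (h₂ : ∀ t ∈ I, HasDerivWithinAt x₂ (a t + b t * x₂ t + c t * x₂ t ^ 2) I t)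
    (h₃ : ∀ t ∈ I, HasDerivWithinAt x₃ (a t + b t * x₃ t + c t * x₃ t ^ 2) I t)
    (h₄ : ∀ t ∈ I, HasDerivWithinAt x₄ (a t + b t * x₄ t + c t * x₄ t ^ 2) I t)
    (hden : ∀ t ∈ I, (x₁ t - x₄ t) * (x₃ t - x₂ t) ≠ 0) :
    ∀ t ∈ I, ∀ t' ∈ I,
      ((x₁ t - x₂ t) * (x₃ t - x₄ t)) / ((x₁ t - x₄ t) * (x₃ t - x₂ t)) =
        ((x₁ t' - x₂ t') * (x₃ t' - x₄ t')) / ((x₁ t' - x₄ t') * (x₃ t' - x₂ t')) := by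
  refine hI.eq_of_hasDerivWithinAt_zero fun t ht => ?_
  have hnum := ((h₁ t ht).sub (h₂ t ht)).mul ((h₃ t ht).sub (h₄ t ht))
  have hdenom := ((h₁ t ht).sub (h₄ t ht)).mul ((h₃ t ht).sub (h₂ t ht))
  refine (hnum.div hdenom (hden t ht)).congr_deriv (div_eq_zero_iff.mpr (Or.inl ?_))
  simp only [Pi.mul_apply, Pi.sub_apply]
  ring
end

section
/- Let I ⊆ ℝ be an interval, let a, b, c : I → ℂ be functions, let x₁, x₂, x₃ : I → ℂ be differentiable functions each satisfying the Riccati equation x′(t) = a(t) + b(t)·x(t) + c(t)·x(t)² on I, and let λ ∈ ℂ. Assume that (x₁(t) − x₂(t)) − λ·(x₃(t) − x₂(t)) ≠ 0 for all t ∈ I. Then the function x(t) = (x₃(t)·(x₁(t) − x₂(t)) − λ·x₁(t)·(x₃(t) − x₂(t))) / ((x₁(t) − x₂(t)) − λ·(x₃(t) − x₂(t))) is differentiable on I and also satisfies x′(t) = a(t) + b(t)·x(t) + c(t)·x(t)² on I; thus this formula is a superposition law for the Riccati equation, expressing a family of solutions in terms of three particular solutions and the arbitrary constant λ. -/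
/-- Superposition law for the Riccati equation: if `x₁, x₂, x₃` are three solutions on an
interval `I ⊆ ℝ` of `x′ = a(t) + b(t)·x + c(t)·x²`, `λ ∈ ℂ` is a constant, and the
denominator `(x₁ - x₂) - λ(x₃ - x₂)` never vanishes on `I`, then
`x = (x₃(x₁ - x₂) - λ·x₁(x₃ - x₂)) / ((x₁ - x₂) - λ(x₃ - x₂))`
is differentiable and is again a solution of the Riccati equation on `I`. -/
theorem riccati_superposition_law
    (I : Set ℝ) (hI : I.OrdConnected) (a b c : ℝ → ℂ)
    (x₁ x₂ x₃ : ℝ → ℂ) (lam : ℂ)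
    (h₁ : ∀ t ∈ I, HasDerivWithinAt x₁ (a t + b t * x₁ t + c t * x₁ t ^ 2) I t)
    (h₂ : ∀ t ∈ I, HasDerivWithinAt x₂ (a t + b t * x₂ t + c t * x₂ t ^ 2) I t)
    (h₃ : ∀ t ∈ I, HasDerivWithinAt x₃ (a t + b t * x₃ t + c t * x₃ t ^ 2) I t)
    (hden : ∀ t ∈ I, (x₁ t - x₂ t) - lam * (x₃ t - x₂ t) ≠ 0)
    (x : ℝ → ℂ)
    (hx : ∀ t, x t = (x₃ t * (x₁ t - x₂ t) - lam * x₁ t * (x₃ t - x₂ t)) /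
      ((x₁ t - x₂ t) - lam * (x₃ t - x₂ t))) :
    ∀ t ∈ I, HasDerivWithinAt x (a t + b t * x t + c t * x t ^ 2) I t := by
  intro t ht
  have hd := hden t ht
  have hu := (h₁ t ht).sub (h₂ t ht)
  have hv := (h₃ t ht).sub (h₂ t ht)
  have hnum := ((h₃ t ht).mul hu).sub (((h₁ t ht).const_mul lam).mul hv)
  have hquot := hnum.div (hu.sub (hv.const_mul lam)) hd
  refine (hquot.congr_deriv ?_).congr (fun s _ => hx s) (hx t)
  rw [hx t]
  simp only [Pi.sub_apply, Pi.mul_apply]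
  field_simp
  ring
end
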